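/- Fix n ≥ 2 and k ≥ 1. The space CD_n(k) of configurations of k causally disjoint rectilinear discs in the n-dimensional unit disc and the space Disc_{n-1}(k) of configurations of k little (n−1)-discs with disjoint interiors are homotopy equivalent topological spaces. -/

import Mathlib

open Set Metric unitInterval

noncomputable section

/-- `n`-dimensional Minkowski space, modeled as `ℝⁿ` with the Euclidean norm. -/
abbrev Mink (n : ℕ) := EuclideanSpace ℝ (Fin n)

/-- The spatial part `x⃗ = (x 1, …, x (n-1)) ∈ ℝ^{n-1}` of `x ∈ ℝⁿ`. -/
def spatial {n : ℕ} (x : Mink n) : Mink (n - 1) :=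
  (WithLp.equiv 2 _).symm fun i : Fin (n - 1) => x ⟨i.1 + 1, by have := i.isLt; omega⟩

/-- A curve `γ` is future-directed causal if it is `C¹` and
`(γ₀)'(t) ≥ ‖(γ⃗)'(t)‖` for all `t ∈ [0,1]`. -/
def FDCausal {n : ℕ} [NeZero n] (γ : ℝ → Mink n) : Prop :=
  ContDiff ℝ 1 γ ∧
    ∀ t ∈ Set.Icc (0 : ℝ) 1,
      ‖deriv (fun s => spatial (γ s)) t‖ ≤ deriv (fun s => γ s 0) t

/-- A curve `γ` is past-directed causal if it is `C¹` and
`-(γ₀)'(t) ≥ ‖(γ⃗)'(t)‖` for all `t ∈ [0,1]`. -/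
def PDCausal {n : ℕ} [NeZero n] (γ : ℝ → Mink n) : Prop :=
  ContDiff ℝ 1 γ ∧
    ∀ t ∈ Set.Icc (0 : ℝ) 1,
      ‖deriv (fun s => spatial (γ s)) t‖ ≤ -(deriv (fun s => γ s 0) t)

/-- A causal curve is a future- or past-directed causal curve. -/
def IsCausalCurve {n : ℕ} [NeZero n] (γ : ℝ → Mink n) : Prop :=
  FDCausal γ ∨ PDCausal γ

/-- `S` and `T` are causally disjoint if no causal curve starts in `S` and ends in `T`. -/
def CausallyDisjoint {n : ℕ} [NeZero n] (S T : Set (Mink n)) : Prop :=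
  ¬ ∃ γ : ℝ → Mink n, IsCausalCurve γ ∧ γ 0 ∈ S ∧ γ 1 ∈ T

/-- The space `CD_n(k)` of `k` causally disjoint rectilinear discs in the unit disc,
recorded as tuples of (radius, center). -/
def CDset (n : ℕ) [NeZero n] (k : ℕ) : Set (Fin k → ℝ × Mink n) :=
  {f | (∀ i, 0 < (f i).1 ∧ (f i).1 + ‖(f i).2‖ ≤ 1) ∧
    ∀ i j, i ≠ j →
      CausallyDisjoint (closedBall (f i).2 (f i).1) (closedBall (f j).2 (f j).1)}

/-- The space `Disc_m(k)` of `k` little `m`-discs with disjoint interiors,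
recorded as tuples of (radius, center). -/
def DiscSet (m k : ℕ) : Set (Fin k → ℝ × Mink m) :=
  {f | (∀ i, 0 < (f i).1 ∧ (f i).1 + ‖(f i).2‖ ≤ 1) ∧
    ∀ i j, i ≠ j →
      Disjoint (ball (f i).2 (f i).1) (ball (f j).2 (f j).1)}

section

variable {n : ℕ}

theorem spatial_apply (x : Mink n) (i : Fin (n - 1)) (h : i.1 + 1 < n) :
    spatial x i = x ⟨i.1 + 1, h⟩ := rfl

theorem spatial_add (x y : Mink n) : spatial (x + y) = spatial x + spatial y := rfl

theorem spatial_sub (x y : Mink n) : spatial (x - y) = spatial x - spatial y := rfl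

theorem spatial_smul (a : ℝ) (x : Mink n) : spatial (a • x) = a • spatial x := rfl

/-- The spatial projection as a continuous linear map. -/
def spatialL (n : ℕ) : Mink n →L[ℝ] Mink (n - 1) :=
  LinearMap.toContinuousLinearMap
    { toFun := spatial
      map_add' := spatial_add
      map_smul' := spatial_smul }

theorem continuous_spatial : Continuous (spatial : Mink n → Mink (n - 1)) :=
  (spatialL n).continuous

/-- The point of Minkowski space with time coordinate `t` and spatial part `c`. -/
def eventOf (t : ℝ) (c : Mink (n - 1)) : Mink n :=
  WithLp.toLp 2 fun i : Fin n =>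
    if h : i.1 = 0 then t else c ⟨i.1 - 1, by have := i.isLt; omega⟩

theorem continuous_eventOf :
    Continuous fun p : ℝ × Mink (n - 1) => (eventOf p.1 p.2 : Mink n) := by
  refine (PiLp.continuous_toLp 2 _).comp (continuous_pi fun i => ?_)
  by_cases h : i.1 = 0
  · simpa only [h, dite_true] using continuous_fst
  · simp only [h, dite_false]
    fun_prop

theorem hasDerivAt_spatial_comp {γ : ℝ → Mink n} (hγ : ContDiff ℝ 1 γ) (t : ℝ) :
    HasDerivAt (fun s => spatial (γ s)) (deriv (fun s => spatial (γ s)) t) t :=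
  (((spatialL n).contDiff.comp hγ).differentiable one_ne_zero t).hasDerivAt

variable [NeZero n]

@[simp]
theorem eventOf_zero (t : ℝ) (c : Mink (n - 1)) : (eventOf t c : Mink n) 0 = t := by
  simp [eventOf]

@[simp]
theorem spatial_eventOf (t : ℝ) (c : Mink (n - 1)) :
    spatial (eventOf t c : Mink n) = c := by
  ext i
  rw [spatial_apply _ _ (by omega)]
  simp [eventOf]

theorem eventOf_eta (x : Mink n) : eventOf (x 0) (spatial x) = x := by
  ext i
  by_cases h : i.1 = 0
  · obtain rfl : i = 0 := Fin.ext (by simpa using h)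
    simp
  · simp only [eventOf, h, dite_false]
    rw [spatial_apply _ _ (by dsimp only; omega)]
    exact congrArg x (Fin.ext (Nat.succ_pred h))

theorem norm_sq_eq_time_add_spatial (x : Mink n) : ‖x‖ ^ 2 = x 0 ^ 2 + ‖spatial x‖ ^ 2 := by
  obtain _ | m := n
  · exact absurd rfl (NeZero.ne 0)
  · rw [EuclideanSpace.norm_sq_eq, EuclideanSpace.norm_sq_eq, Fin.sum_univ_succ]
    simp only [Real.norm_eq_abs, sq_abs]
    rfl

theorem norm_spatial_le (x : Mink n) : ‖spatial x‖ ≤ ‖x‖ :=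
  abs_le_of_sq_le_sq' (by nlinarith [norm_sq_eq_time_add_spatial x, sq_nonneg (x 0)])
    (norm_nonneg x) |>.2

theorem abs_time_add_norm_spatial_le (x : Mink n) : |x 0| + ‖spatial x‖ ≤ √2 * ‖x‖ := by
  refine abs_le_of_sq_le_sq' ?_ (by positivity) |>.2
  rw [mul_pow, Real.sq_sqrt zero_le_two, norm_sq_eq_time_add_spatial]
  nlinarith [sq_abs (x 0), sq_nonneg (|x 0| - ‖spatial x‖)]

theorem norm_eventOf_mul_le {t : ℝ} (ht₀ : 0 ≤ t) (ht₁ : t ≤ 1) (x : Mink n) :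
    ‖(eventOf (t * x 0) (spatial x) : Mink n)‖ ≤ ‖x‖ := by
  refine abs_le_of_sq_le_sq' ?_ (norm_nonneg x) |>.2
  rw [norm_sq_eq_time_add_spatial, norm_sq_eq_time_add_spatial x, eventOf_zero, spatial_eventOf,
    mul_pow]
  gcongr
  exact mul_le_of_le_one_left (sq_nonneg _) (pow_le_one₀ ht₀ ht₁)

theorem norm_eventOf_zero (c : Mink (n - 1)) : ‖(eventOf 0 c : Mink n)‖ = ‖c‖ := by
  rw [← sq_eq_sq₀ (norm_nonneg _) (norm_nonneg _), norm_sq_eq_time_add_spatial]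
  simp

theorem hasDerivAt_time_comp {γ : ℝ → Mink n} (hγ : ContDiff ℝ 1 γ) (t : ℝ) :
    HasDerivAt (fun s => γ s 0) (deriv (fun s => γ s 0) t) t :=
  ((contDiff_euclidean.1 hγ 0).differentiable one_ne_zero t).hasDerivAt

theorem IsCausalCurve.norm_spatial_sub_le {γ : ℝ → Mink n} (h : IsCausalCurve γ) :
    ‖spatial (γ 0) - spatial (γ 1)‖ ≤ |γ 0 0 - γ 1 0| := by
  obtain ⟨ε, hε, hγ, hd⟩ : ∃ ε : ℝ, |ε| = 1 ∧ ContDiff ℝ 1 γ ∧ ∀ t ∈ Set.Icc (0 : ℝ) 1,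
      ‖deriv (fun s => spatial (γ s)) t‖ ≤ ε * deriv (fun s => γ s 0) t := by
    rcases h with ⟨hγ, hd⟩ | ⟨hγ, hd⟩
    · exact ⟨1, by simp, hγ, by simpa using hd⟩
    · exact ⟨-1, by simp, hγ, by simpa using hd⟩
  have key := image_norm_le_of_norm_deriv_right_le_deriv_boundary
    (f := fun s => spatial (γ s) - spatial (γ 0)) (a := 0) (b := 1)
    (B := fun s => ε * (γ s 0 - γ 0 0))
    (fun t _ => ((hasDerivAt_spatial_comp hγ t).sub_const _).continuousAt.continuousWithinAt)
    (fun t _ => ((hasDerivAt_spatial_comp hγ t).sub_const _).hasDerivWithinAt)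
    (by simp)
    (fun t => ((hasDerivAt_time_comp hγ t).sub_const _).const_mul ε)
    (fun t ht => hd t ⟨ht.1, ht.2.le⟩) (right_mem_Icc.2 zero_le_one)
  rw [norm_sub_rev, abs_sub_comm]
  refine key.trans ((le_abs_self _).trans ?_)
  rw [abs_mul, hε, one_mul]

theorem exists_isCausalCurve {x y : Mink n} (h : ‖spatial x - spatial y‖ ≤ |x 0 - y 0|) :
    ∃ γ : ℝ → Mink n, IsCausalCurve γ ∧ γ 0 = x ∧ γ 1 = y := by
  have hγ : ContDiff ℝ 1 fun t : ℝ => x + t • (y - x) := by fun_prop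
  have hs (t : ℝ) : deriv (fun s : ℝ => spatial (x + s • (y - x))) t = spatial (y - x) := by
    have := ((hasDerivAt_id t).smul_const (spatial (y - x))).const_add (spatial x)
    simpa [spatial_add, spatial_smul] using this.deriv
  have ht (t : ℝ) : deriv (fun s : ℝ => (x + s • (y - x)) 0) t = y 0 - x 0 := by
    have := ((hasDerivAt_id t).mul_const (y 0 - x 0)).const_add (x 0)
    exact this.deriv.trans (one_mul _)
  refine ⟨fun t => x + t • (y - x), ?_, by simp, by simp⟩
  rw [norm_sub_rev, ← spatial_sub] at h
  rcases le_total (x 0) (y 0) with hle | hle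
  · refine Or.inl ⟨hγ, fun t _ => ?_⟩
    rw [hs, ht]
    rwa [abs_of_nonpos (by linarith), neg_sub] at h
  · refine Or.inr ⟨hγ, fun t _ => ?_⟩
    rw [hs, ht, neg_sub]
    rwa [abs_of_nonneg (by linarith)] at h

theorem causallyDisjoint_iff {S T : Set (Mink n)} :
    CausallyDisjoint S T ↔ ∀ x ∈ S, ∀ y ∈ T, |x 0 - y 0| < ‖spatial x - spatial y‖ := by
  constructor
  · intro h x hx y hy
    by_contra! hle
    obtain ⟨γ, hγ, rfl, rfl⟩ := exists_isCausalCurve hle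
    exact h ⟨γ, hγ, hx, hy⟩
  · rintro h ⟨γ, hγ, h₀, h₁⟩
    exact (h _ h₀ _ h₁).not_ge hγ.norm_spatial_sub_le

theorem causallyDisjoint_closedBall_iff {b b' : Mink n} {r r' : ℝ} (hr : 0 ≤ r) (hr' : 0 ≤ r') :
    CausallyDisjoint (closedBall b r) (closedBall b' r') ↔
      √2 * (r + r') + |b 0 - b' 0| < ‖spatial b - spatial b'‖ := by
  rw [causallyDisjoint_iff]
  constructor
  · intro h
    by_contra! hle
    set D := ‖spatial b - spatial b'‖ with hD
    have hpos : 0 < D :=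
      (abs_nonneg _).trans_lt (h b (mem_closedBall_self hr) b' (mem_closedBall_self hr'))
    obtain ⟨ε, hε, hεb⟩ : ∃ ε : ℝ, ε ^ 2 = 1 ∧ b 0 - b' 0 = ε * |b 0 - b' 0| := by
      rcases le_total 0 (b 0 - b' 0) with h0 | h0
      · exact ⟨1, by norm_num, by rw [abs_of_nonneg h0, one_mul]⟩
      · exact ⟨-1, by norm_num, by rw [abs_of_nonpos h0]; ring⟩
    have h2 : √2 ^ 2 = 2 := Real.sq_sqrt zero_le_two
    set q : ℝ := √2 / 2 with hq
    have hq2 : 2 * q ^ 2 = 1 := by rw [hq, div_pow, h2]; norm_num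
    have hq0 : 0 ≤ q := by positivity
    -- a null direction pointing from `b` towards the light cone of `b'`
    let w : Mink n := eventOf (ε * q) ((-q * D⁻¹) • (spatial b - spatial b'))
    have hw : ‖w‖ = 1 := by
      rw [← sq_eq_sq₀ (norm_nonneg _) zero_le_one, norm_sq_eq_time_add_spatial, eventOf_zero,
        spatial_eventOf, norm_smul, mul_pow, mul_pow, hε, ← hD, Real.norm_eq_abs, sq_abs]
      field_simp
      linarith
    have hx : b + r • w ∈ closedBall b r := by
      simp [norm_smul, hw, abs_of_nonneg hr]
    have hy : b' - r' • w ∈ closedBall b' r' := by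
      simp [norm_smul, hw, abs_of_nonneg hr']
    have hlt := h _ hx _ hy
    have hw0 : w 0 = ε * q := eventOf_zero _ _
    have htime : (b + r • w) 0 - (b' - r' • w) 0 = ε * (|b 0 - b' 0| + q * (r + r')) := by
      simp only [PiLp.add_apply, PiLp.sub_apply, PiLp.smul_apply, smul_eq_mul, hw0]
      linear_combination hεb
    have hspace : spatial (b + r • w) - spatial (b' - r' • w) =
        ((D - q * (r + r')) * D⁻¹) • (spatial b - spatial b') := by
      have hone : spatial b - spatial b' = (D * D⁻¹) • (spatial b - spatial b') := by
        rw [mul_inv_cancel₀ hpos.ne', one_smul]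
      have hws : spatial w = (-q * D⁻¹) • (spatial b - spatial b') := spatial_eventOf _ _
      rw [spatial_add, spatial_sub, spatial_smul, spatial_smul, hws, sub_mul, sub_smul, ← hone]
      module
    have hε_abs : |ε| = 1 := by
      rw [← sq_eq_sq₀ (abs_nonneg _) zero_le_one, sq_abs, hε, one_pow]
    rw [htime, hspace, norm_smul, ← hD, abs_mul, hε_abs, one_mul, Real.norm_eq_abs, abs_mul,
      abs_of_pos (inv_pos.2 hpos), mul_assoc, inv_mul_cancel₀ hpos.ne', mul_one,
      abs_of_nonneg (by positivity)] at hlt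
    have hqq : √2 * (r + r') = 2 * (q * (r + r')) := by rw [hq]; ring
    refine hlt.not_ge (abs_le.2 ⟨?_, ?_⟩) <;> linarith [abs_nonneg (b 0 - b' 0)]
  · intro h x hx y hy
    rw [mem_closedBall_iff_norm] at hx hy
    have h2 : 0 ≤ √2 := Real.sqrt_nonneg 2
    have hxb := (abs_time_add_norm_spatial_le (x - b)).trans (mul_le_mul_of_nonneg_left hx h2)
    have hyb := (abs_time_add_norm_spatial_le (y - b')).trans (mul_le_mul_of_nonneg_left hy h2)
    rw [spatial_sub, PiLp.sub_apply] at hxb hyb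
    have htime : |x 0 - y 0| ≤ |x 0 - b 0| + |b 0 - b' 0| + |y 0 - b' 0| := by
      rw [abs_sub_comm (y 0)]
      exact (abs_sub_le _ (b' 0) _).trans (add_le_add_left (abs_sub_le _ (b 0) _) _)
    have hspace : ‖spatial b - spatial b'‖ ≤
        ‖spatial x - spatial b‖ + ‖spatial x - spatial y‖ + ‖spatial y - spatial b'‖ := by
      rw [norm_sub_rev (spatial x) (spatial b)]
      exact (norm_sub_le_norm_sub_add_norm_sub _ (spatial y) _).trans
        (add_le_add_left (norm_sub_le_norm_sub_add_norm_sub _ (spatial x) _) _)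
    linarith

theorem mem_CDset_iff {k : ℕ} {f : Fin k → ℝ × Mink n} :
    f ∈ CDset n k ↔ (∀ i, 0 < (f i).1 ∧ (f i).1 + ‖(f i).2‖ ≤ 1) ∧
      ∀ i j, i ≠ j → √2 * ((f i).1 + (f j).1) + |(f i).2 0 - (f j).2 0| <
        ‖spatial (f i).2 - spatial (f j).2‖ :=
  and_congr_right fun h => forall₃_congr fun i j _ =>
    causallyDisjoint_closedBall_iff (h i).1.le (h j).1.le

theorem mem_DiscSet_iff {m k : ℕ} {f : Fin k → ℝ × Mink m} :
    f ∈ DiscSet m k ↔ (∀ i, 0 < (f i).1 ∧ (f i).1 + ‖(f i).2‖ ≤ 1) ∧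
      ∀ i j, i ≠ j → (f i).1 + (f j).1 ≤ ‖(f i).2 - (f j).2‖ :=
  and_congr_right fun h => forall₃_congr fun i j _ => by
    rw [disjoint_ball_ball_iff (h i).1 (h j).1, dist_eq_norm]

theorem continuous_coe_apply {k : ℕ} {α : Type*} [TopologicalSpace α] (s : Set (Fin k → α))
    (i : Fin k) : Continuous fun f : s => f.1 i :=
  (continuous_apply i).comp continuous_subtype_val

theorem spatial_mem_DiscSet {k : ℕ} {f : Fin k → ℝ × Mink n} (hf : f ∈ CDset n k) :
    (fun i => ((f i).1, spatial (f i).2)) ∈ DiscSet (n - 1) k := by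
  rw [mem_CDset_iff] at hf
  refine mem_DiscSet_iff.2 ⟨fun i => ⟨(hf.1 i).1, ?_⟩, fun i j hij => ?_⟩
  · exact (add_le_add_right (norm_spatial_le _) _).trans (hf.1 i).2
  · have := hf.2 i j hij
    have h1 : 1 ≤ √2 := Real.one_le_sqrt.2 one_le_two
    dsimp only
    nlinarith [abs_nonneg ((f i).2 0 - (f j).2 0), (hf.1 i).1, (hf.1 j).1]

theorem eventOf_mem_CDset {k : ℕ} {f : Fin k → ℝ × Mink (n - 1)} (hf : f ∈ DiscSet (n - 1) k) :
    (fun i => ((f i).1 / 2, eventOf 0 (f i).2)) ∈ CDset n k := by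
  rw [mem_DiscSet_iff] at hf
  refine mem_CDset_iff.2 ⟨fun i => ⟨half_pos (hf.1 i).1, ?_⟩, fun i j hij => ?_⟩
  · rw [norm_eventOf_zero]
    linarith [(hf.1 i).1, (hf.1 i).2]
  · have := hf.2 i j hij
    have h2 : √2 < 2 := by
      rw [Real.sqrt_lt' two_pos]
      norm_num
    simp only [spatial_eventOf, eventOf_zero, sub_self, abs_zero, add_zero]
    nlinarith [(hf.1 i).1, (hf.1 j).1]

theorem CDset_flatten_mem {k : ℕ} {f : Fin k → ℝ × Mink n} (hf : f ∈ CDset n k) {t : ℝ}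
    (ht₀ : 0 ≤ t) (ht₁ : t ≤ 1) :
    (fun i => ((1 + t) / 2 * (f i).1, eventOf (t * (f i).2 0) (spatial (f i).2))) ∈ CDset n k := by
  rw [mem_CDset_iff] at hf
  refine mem_CDset_iff.2 ⟨fun i => ⟨mul_pos (by linarith) (hf.1 i).1, ?_⟩, fun i j hij => ?_⟩
  · have := norm_eventOf_mul_le ht₀ ht₁ (f i).2
    nlinarith [(hf.1 i).1, (hf.1 i).2]
  · simp only [spatial_eventOf, eventOf_zero]
    refine lt_of_le_of_lt (add_le_add ?_ ?_) (hf.2 i j hij)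
    · rw [← mul_add]
      refine mul_le_mul_of_nonneg_left ?_ (Real.sqrt_nonneg 2)
      exact mul_le_of_le_one_left (add_pos (hf.1 i).1 (hf.1 j).1).le (by linarith)
    · rw [← mul_sub, abs_mul, abs_of_nonneg ht₀]
      exact mul_le_of_le_one_left (abs_nonneg _) ht₁

theorem DiscSet_shrink_mem {m k : ℕ} {f : Fin k → ℝ × Mink m} (hf : f ∈ DiscSet m k) {t : ℝ}
    (ht₀ : 0 ≤ t) (ht₁ : t ≤ 1) :
    (fun i => ((1 + t) / 2 * (f i).1, (f i).2)) ∈ DiscSet m k := by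
  rw [mem_DiscSet_iff] at hf
  have hle (i) : (1 + t) / 2 * (f i).1 ≤ (f i).1 :=
    mul_le_of_le_one_left (hf.1 i).1.le (by linarith)
  refine mem_DiscSet_iff.2 ⟨fun i => ⟨mul_pos (by linarith) (hf.1 i).1, ?_⟩, fun i j hij => ?_⟩
  · exact (add_le_add_left (hle i) _).trans (hf.1 i).2
  · exact (add_le_add (hle i) (hle j)).trans (hf.2 i j hij)

/-- Forgetting the time coordinates of the centers. -/
def cdToDisc (n k : ℕ) [NeZero n] : C(CDset n k, DiscSet (n - 1) k) where
  toFun f := ⟨fun i => ((f.1 i).1, spatial (f.1 i).2), spatial_mem_DiscSet f.2⟩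
  continuous_toFun := by
    refine Continuous.subtype_mk (continuous_pi fun i => ?_) _
    have h := continuous_coe_apply (CDset n k) i
    exact h.fst.prodMk (continuous_spatial.comp h.snd)

/-- Placing discs of half the radius in the time-zero slice. -/
def discToCD (n k : ℕ) [NeZero n] : C(DiscSet (n - 1) k, CDset n k) where
  toFun f := ⟨fun i => ((f.1 i).1 / 2, eventOf 0 (f.1 i).2), eventOf_mem_CDset f.2⟩
  continuous_toFun := by
    refine Continuous.subtype_mk (continuous_pi fun i => ?_) _
    have h := continuous_coe_apply (DiscSet (n - 1) k) i
    exact (h.fst.div_const 2).prodMk (continuous_eventOf.comp (continuous_const.prodMk h.snd))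

/-- The homotopy flattening a configuration of causally disjoint discs to the time-zero slice. -/
def cdHomotopy (n k : ℕ) [NeZero n] :
    ((discToCD n k).comp (cdToDisc n k)).Homotopy (ContinuousMap.id (CDset n k)) where
  toFun p := ⟨fun i => ((1 + (p.1 : ℝ)) / 2 * (p.2.1 i).1,
    eventOf ((p.1 : ℝ) * (p.2.1 i).2 0) (spatial (p.2.1 i).2)),
    CDset_flatten_mem p.2.2 p.1.2.1 p.1.2.2⟩
  continuous_toFun := by
    refine Continuous.subtype_mk (continuous_pi fun i => ?_) _
    have h := (continuous_coe_apply (CDset n k) i).comp (continuous_snd (X := I))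
    have ht : Continuous fun p : I × CDset n k => (p.1 : ℝ) :=
      continuous_subtype_val.comp continuous_fst
    have h₀ : Continuous fun x : Mink n => x 0 := by fun_prop
    exact (((continuous_const.add ht).div_const 2).mul h.fst).prodMk
      (continuous_eventOf.comp
        ((ht.mul (h₀.comp h.snd)).prodMk (continuous_spatial.comp h.snd)))
  map_zero_left f := by
    refine Subtype.ext (funext fun i => Prod.ext ?_ ?_)
    · change (1 + (0 : ℝ)) / 2 * (f.1 i).1 = (f.1 i).1 / 2
      ring
    · change eventOf ((0 : ℝ) * (f.1 i).2 0) (spatial (f.1 i).2) = eventOf 0 (spatial (f.1 i).2)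
      rw [zero_mul]
  map_one_left f := by
    refine Subtype.ext (funext fun i => Prod.ext ?_ ?_)
    · change (1 + (1 : ℝ)) / 2 * (f.1 i).1 = (f.1 i).1
      ring
    · change eventOf ((1 : ℝ) * (f.1 i).2 0) (spatial (f.1 i).2) = (f.1 i).2
      rw [one_mul, eventOf_eta]

/-- The homotopy halving the radii of a configuration of little discs. -/
def discHomotopy (n k : ℕ) [NeZero n] :
    ((cdToDisc n k).comp (discToCD n k)).Homotopy (ContinuousMap.id (DiscSet (n - 1) k)) where
  toFun p := ⟨fun i => ((1 + (p.1 : ℝ)) / 2 * (p.2.1 i).1, (p.2.1 i).2),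
    DiscSet_shrink_mem p.2.2 p.1.2.1 p.1.2.2⟩
  continuous_toFun := by
    refine Continuous.subtype_mk (continuous_pi fun i => ?_) _
    have h := (continuous_coe_apply (DiscSet (n - 1) k) i).comp (continuous_snd (X := I))
    have ht : Continuous fun p : I × DiscSet (n - 1) k => (p.1 : ℝ) :=
      continuous_subtype_val.comp continuous_fst
    exact (((continuous_const.add ht).div_const 2).mul h.fst).prodMk h.snd
  map_zero_left f := by
    refine Subtype.ext (funext fun i => Prod.ext ?_ ?_)
    · change (1 + (0 : ℝ)) / 2 * (f.1 i).1 = (f.1 i).1 / 2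
      ring
    · exact (spatial_eventOf 0 (f.1 i).2).symm
  map_one_left f := by
    refine Subtype.ext (funext fun i => Prod.ext ?_ rfl)
    change (1 + (1 : ℝ)) / 2 * (f.1 i).1 = (f.1 i).1
    ring

end

/-- The spaces `CD_n(k)` and `Disc_{n-1}(k)` are homotopy equivalent. -/
theorem cd_homotopyEquiv_disc (n k : ℕ) [NeZero n] (hn : 2 ≤ n) (hk : 1 ≤ k) :
    Nonempty (ContinuousMap.HomotopyEquiv (CDset n k) (DiscSet (n - 1) k)) :=
  ⟨⟨cdToDisc n k, discToCD n k, ⟨cdHomotopy n k⟩, ⟨discHomotopy n k⟩⟩⟩
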